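/- For every m ≥ 2 and every j with 0 ≤ j ≤ m−1, the extremal weight projector annihilates all cap-cup generators: t_m ∘ u_j = u_j ∘ t_m = 0 in End(V^{⊗m}). -/

import Mathlib

open Matrix

noncomputable section

/-- Sign strings `ε ∈ {+,-}^m`; `true` encodes `+` and `false` encodes `-`. -/
abbrev Sgn (m : ℕ) := Fin m → Bool

/-- Endomorphisms of `V^{⊗m}` (`V = ℂ²`), as matrices indexed by sign strings. -/
abbrev Op (m : ℕ) := Matrix (Sgn m) (Sgn m) ℂ

/-- Linear maps `V^{⊗m} → V^{⊗n}`, as matrices (rows: target, columns: source). -/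
abbrev Mor (m n : ℕ) := Matrix (Sgn n) (Sgn m) ℂ

/-- The basis vector `v_ε` of `V^{⊗m}`. -/
def bv {m : ℕ} (ε : Sgn m) : Sgn m → ℂ := fun δ => if δ = ε then 1 else 0

/-- The coefficient of `cap` on `v_a ⊗ v_b`:
`cap (v₋ ⊗ v₊) = 1`, `cap (v₊ ⊗ v₋) = -1`, `cap (v₊ ⊗ v₊) = cap (v₋ ⊗ v₋) = 0`. -/
def capc (a b : Bool) : ℂ := if a then (if b then 0 else -1) else (if b then 1 else 0)

/-- The coefficient of `v_a ⊗ v_b` in `cup 1 = v₊ ⊗ v₋ - v₋ ⊗ v₊`. -/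
def cupc (a b : Bool) : ℂ := if a then (if b then 0 else 1) else (if b then -1 else 0)

/-- The cap `V ⊗ V → ℂ`. -/
def capM : Mor 2 0 := Matrix.of fun _ ε => capc (ε 0) (ε 1)

/-- The cup `ℂ → V ⊗ V`. -/
def cupM : Mor 0 2 := Matrix.of fun δ _ => cupc (δ 0) (δ 1)

/-- The tensor product of two linear maps. -/
def tensMor {a b c d : ℕ} (A : Mor a b) (B : Mor c d) : Mor (a + c) (b + d) :=
  Matrix.of fun δ ε =>
    A (fun i => δ (Fin.castAdd d i)) (fun i => ε (Fin.castAdd c i)) *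
      B (fun j => δ (Fin.natAdd b j)) (fun j => ε (Fin.natAdd a j))

/-- The swap of the two tensor factors of `V ⊗ V`. -/
def swap2 : Op 2 := Matrix.of fun δ ε => if δ 0 = ε 1 ∧ δ 1 = ε 0 then 1 else 0

/-- `id^{⊗p} ⊗ A ⊗ id^{⊗(m-p-2)}`: the operator `A` on two strands placed at the
(0-based) positions `p`, `p+1` among `m` strands. -/
def atPos (m p : ℕ) (A : Op 2) : Op m :=
  Matrix.of fun δ ε =>
    if h : p + 2 ≤ m then
      (if ∀ k : Fin m, k.val ≠ p → k.val ≠ p + 1 → δ k = ε k then 1 else 0) *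
        A (fun i => δ ⟨p + i.val, Nat.lt_of_lt_of_le (Nat.add_lt_add_left i.isLt p) h⟩)
          (fun i => ε ⟨p + i.val, Nat.lt_of_lt_of_le (Nat.add_lt_add_left i.isLt p) h⟩)
    else 0

/-- Cyclic rotation of sign strings: `(rotIdx δ) k = δ (k+1 mod m)`. -/
def rotIdx {m : ℕ} (δ : Sgn m) : Sgn m := fun k => δ ⟨(k.val + 1) % m, Nat.mod_lt _ k.pos⟩

/-- The rotation `d_m : V^{⊗m} → V^{⊗m}`, `d_m (v_ε ⊗ w) = i^{ε} (w ⊗ v_ε)`. -/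
def dRot : (m : ℕ) → Op m
  | 0 => 1
  | (m + 1) =>
    Matrix.of fun δ' δ =>
      if δ' = rotIdx δ then (if δ 0 then Complex.I else -Complex.I) else 0

/-- The cap-cup generator `u_j` (`j` is 1-based, `1 ≤ j ≤ m-1`);
`u_0 := d_m⁻¹ ∘ u_1 ∘ d_m` is the affine generator. -/
def uFull (m j : ℕ) : Op m :=
  if j = 0 then (dRot m)⁻¹ * atPos m 0 (cupM * capM) * dRot m
  else atPos m (j - 1) (cupM * capM)

/-- The extremal weight projectors `t_m`, defined by `t₁ = id`,
`t₂ = id + u₁/2 + u₀/2`, and `t_{m+1} = (t_m ⊗ id) ∘ σ_m ∘ (t_m ⊗ id)` for `m ≥ 2`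
(with the convention `t₀ = 2·id`). -/
def tP : (m : ℕ) → Op m
  | 0 => (2 : ℂ) • 1
  | 1 => 1
  | 2 => 1 + (2⁻¹ : ℂ) • atPos 2 0 (cupM * capM) +
      (2⁻¹ : ℂ) • ((dRot 2)⁻¹ * atPos 2 0 (cupM * capM) * dRot 2)
  | (m + 3) =>
    tensMor (tP (m + 2)) (1 : Op 1) * atPos (m + 3) (m + 1) swap2 *
      tensMor (tP (m + 2)) (1 : Op 1)

/-- `n` nested caps `Ca_n : V^{⊗2n} → ℂ`. -/
def CaM (n : ℕ) : Mor (n + n) 0 :=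
  Matrix.of fun _ δ =>
    ∏ k : Fin n,
      capc (δ ⟨k.val, Nat.lt_of_lt_of_le k.isLt (Nat.le_add_right n n)⟩)
        (δ ⟨n + n - 1 - k.val,
          Nat.lt_of_le_of_lt (Nat.sub_le _ _)
            (Nat.sub_lt (Nat.lt_of_lt_of_le k.pos (Nat.le_add_right n n)) Nat.one_pos)⟩)

/-- `n` nested cups `Cu_n : ℂ → V^{⊗2n}`. -/
def CuM (n : ℕ) : Mor 0 (n + n) :=
  Matrix.of fun δ _ =>
    ∏ k : Fin n,
      cupc (δ ⟨k.val, Nat.lt_of_lt_of_le k.isLt (Nat.le_add_right n n)⟩)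
        (δ ⟨n + n - 1 - k.val,
          Nat.lt_of_le_of_lt (Nat.sub_le _ _)
            (Nat.sub_lt (Nat.lt_of_lt_of_le k.pos (Nat.le_add_right n n)) Nat.one_pos)⟩)

/-- The canonical identification of sign strings induced by an equality of lengths. -/
def sgnCast {a b : ℕ} (h : a = b) : Sgn a ≃ Sgn b :=
  Equiv.arrowCongr (finCongr h) (Equiv.refl Bool)

/-- Reindexing of a linear map along equalities of the numbers of strands. -/
def rc {a b c d : ℕ} (h1 : a = b) (h2 : c = d) (A : Mor a c) : Mor b d :=
  Matrix.reindex (sgnCast h2) (sgnCast h1) A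

/-- The idempotents `e_{m,n}`:
`e_{1,1} = -u₁/2 - d₂⁻¹ ∘ u₁ ∘ d₂ / 2` and
`e_{m,n} = -(t_m ⊗ t_n) ∘ u_m ∘ (t_m ⊗ t_n)` otherwise. -/
def eP : (m n : ℕ) → Op (m + n)
  | 1, 1 =>
    (-(2⁻¹ : ℂ)) • atPos 2 0 (cupM * capM) +
      (-(2⁻¹ : ℂ)) • ((dRot 2)⁻¹ * atPos 2 0 (cupM * capM) * dRot 2)
  | m, n =>
    -(tensMor (tP m) (tP n) * atPos (m + n) (m - 1) (cupM * capM) * tensMor (tP m) (tP n))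

/-- The projection onto the span of the two extremal weight vectors `v_{+⋯+}` and `v_{-⋯-}`. -/
def extremalProj (m : ℕ) : Op m :=
  Matrix.diagonal fun ε => if ∀ i j, ε i = ε j then 1 else 0

lemma cup_mul_cap_apply (δ ε : Sgn 2) :
    (cupM * capM) δ ε = cupc (δ 0) (δ 1) * capc (ε 0) (ε 1) := by
  simp [Matrix.mul_apply, cupM, capM]

lemma cupc_self (a : Bool) : cupc a a = 0 := by cases a <;> simp [cupc]

lemma capc_self (a : Bool) : capc a a = 0 := by cases a <;> simp [capc]

lemma extremalProj_mul_capcup (m p : ℕ) :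
    extremalProj m * atPos m p (cupM * capM) = 0 := by
  ext δ ε
  by_cases h : ∀ i j, δ i = δ j
  · by_cases hp : p + 2 ≤ m
    · simp only [extremalProj, Matrix.diagonal_mul, atPos, Matrix.of_apply, cup_mul_cap_apply,
        dif_pos hp, h ⟨p + (0 : Fin 2).val, by simp; omega⟩ ⟨p + (1 : Fin 2).val, by simp; omega⟩,
        cupc_self]
      simp
    · simp [extremalProj, Matrix.diagonal_mul, atPos, hp]
  · simp [extremalProj, Matrix.diagonal_mul, h]

lemma capcup_mul_extremalProj (m p : ℕ) :
    atPos m p (cupM * capM) * extremalProj m = 0 := by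
  ext δ ε
  by_cases h : ∀ i j, ε i = ε j
  · by_cases hp : p + 2 ≤ m
    · simp only [extremalProj, Matrix.mul_diagonal, atPos, Matrix.of_apply, cup_mul_cap_apply,
        dif_pos hp, h ⟨p + (0 : Fin 2).val, by simp; omega⟩ ⟨p + (1 : Fin 2).val, by simp; omega⟩,
        capc_self]
      simp
    · simp [extremalProj, Matrix.mul_diagonal, atPos, hp]
  · simp [extremalProj, Matrix.mul_diagonal, h]

lemma rotIdx_const_iff {m : ℕ} (δ : Sgn m) :
    (∀ i j, rotIdx δ i = rotIdx δ j) ↔ ∀ i j, δ i = δ j := by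
  refine ⟨fun h i j => ?_, fun h i j => h _ _⟩
  have key : ∀ i : Fin m, ∃ k, rotIdx δ k = δ i := by
    rintro ⟨i, hi⟩
    refine ⟨⟨(i + (m - 1)) % m, Nat.mod_lt _ (by omega)⟩, ?_⟩
    simp only [rotIdx, Nat.mod_add_mod]
    congr 2
    rw [show i + (m - 1) + 1 = i + m by omega, Nat.add_mod_right, Nat.mod_eq_of_lt hi]
  obtain ⟨k, hk⟩ := key i
  obtain ⟨l, hl⟩ := key j
  rw [← hk, ← hl, h]

lemma extremalProj_commute_dRot (m : ℕ) : Commute (extremalProj m) (dRot m) := by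
  cases m with
  | zero => exact Commute.one_right _
  | succ m =>
    ext δ ε
    simp only [extremalProj, Matrix.diagonal_mul, Matrix.mul_diagonal, dRot, Matrix.of_apply]
    by_cases h : δ = rotIdx ε
    · subst h
      simp only [rotIdx_const_iff, mul_comm]
    · simp [h]

lemma Matrix.commute_inv_right {n R : Type*} [Fintype n] [DecidableEq n] [CommRing R]
    {A B : Matrix n n R} (h : Commute A B) : Commute A B⁻¹ := by
  by_cases hB : IsUnit B.det
  · calc A * B⁻¹ = B⁻¹ * B * (A * B⁻¹) := by rw [Matrix.nonsing_inv_mul _ hB, one_mul]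
      _ = B⁻¹ * (A * B) * B⁻¹ := by rw [h.eq]; simp only [mul_assoc]
      _ = B⁻¹ * A := by rw [mul_assoc, mul_assoc, Matrix.mul_nonsing_inv _ hB, mul_one]
  · rw [Matrix.nonsing_inv_apply_not_isUnit _ hB]
    exact Commute.zero_right _

lemma sum_sgn_two (f : Sgn 2 → ℂ) :
    ∑ δ, f δ = f ![true, true] + f ![true, false] + f ![false, true] + f ![false, false] := by
  rw [← (finTwoArrowEquiv Bool).symm.sum_comp, Fintype.sum_prod_type]
  simp [finTwoArrowEquiv, add_assoc]

lemma forall_sgn_two {P : Sgn 2 → Prop} (h : ∀ a b, P ![a, b]) (δ : Sgn 2) : P δ := by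
  have : δ = ![δ 0, δ 1] := by ext i; fin_cases i <;> rfl
  rw [this]; exact h _ _

lemma rotIdx_two (a b : Bool) : rotIdx (m := 2) ![a, b] = ![b, a] := by
  ext i; fin_cases i <;> rfl

lemma dRot_two_apply (a b c d : Bool) :
    dRot 2 ![a, b] ![c, d] = if a = d ∧ b = c then (if c then Complex.I else -Complex.I) else 0 := by
  simp only [dRot, rotIdx_two, Matrix.of_apply, Matrix.vecCons_inj, and_true]
  congr 1

lemma dRot_two_inv : (dRot 2)⁻¹ = (dRot 2)ᴴ := by
  refine Matrix.inv_eq_right_inv ?_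
  ext δ ε
  induction δ using forall_sgn_two with | h a b
  induction ε using forall_sgn_two with | h c d
  simp only [Matrix.mul_apply, sum_sgn_two, Matrix.conjTranspose_apply, dRot_two_apply,
    Matrix.one_apply]
  cases a <;> cases b <;> cases c <;> cases d <;> simp

lemma atPos_two_zero (A : Op 2) : atPos 2 0 A = A := by
  ext δ ε
  have h : ∀ k : Fin 2, k.val ≠ 0 → k.val ≠ 0 + 1 → δ k = ε k := fun k => by omega
  simp only [atPos, Matrix.of_apply, if_pos h, zero_add, one_mul]
  rfl

lemma tP_two : tP 2 = extremalProj 2 := by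
  ext δ ε
  induction δ using forall_sgn_two with | h a b
  induction ε using forall_sgn_two with | h c d
  simp only [tP, atPos_two_zero, dRot_two_inv, Matrix.add_apply, Matrix.smul_apply,
    Matrix.mul_apply (M := _ * _), Matrix.mul_apply (M := (dRot 2)ᴴ), sum_sgn_two,
    Matrix.conjTranspose_apply, dRot_two_apply, Matrix.one_apply, cup_mul_cap_apply,
    extremalProj, Matrix.diagonal_apply, Fin.forall_fin_two]
  cases a <;> cases b <;> cases c <;> cases d <;> norm_num [cupc, capc]

lemma tensMor_extremalProj_one (m : ℕ) :
    tensMor (extremalProj m) (1 : Op 1) =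
      Matrix.diagonal fun ε : Sgn (m + 1) =>
        if ∀ i j : Fin m, ε i.castSucc = ε j.castSucc then 1 else 0 := by
  ext δ ε
  have key : δ = ε ↔ (fun i : Fin m => δ i.castSucc) = (fun i => ε i.castSucc) ∧
      (fun j : Fin 1 => δ (Fin.natAdd m j)) = (fun j => ε (Fin.natAdd m j)) := by
    simp only [funext_iff, Fin.forall_fin_one]
    exact Fin.forall_fin_succ'
  simp only [tensMor, extremalProj, Matrix.of_apply, Matrix.diagonal_apply, Matrix.one_apply, key]
  by_cases h : (fun i : Fin m => δ i.castSucc) = (fun i => ε i.castSucc) <;>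
    by_cases h' : (fun j : Fin 1 => δ (Fin.natAdd m j)) = (fun j => ε (Fin.natAdd m j)) <;>
    simp_all [Fin.castSucc]

lemma extremalProj_succ (m : ℕ) :
    tensMor (extremalProj (m + 2)) (1 : Op 1) * atPos (m + 3) (m + 1) swap2 *
      tensMor (extremalProj (m + 2)) (1 : Op 1) = extremalProj (m + 3) := by
  rw [tensMor_extremalProj_one]
  ext δ ε
  simp only [extremalProj, Matrix.diagonal_mul, Matrix.mul_diagonal, Matrix.diagonal_apply, atPos,
    Matrix.of_apply, dif_pos (le_refl (m + 3)), swap2, ← ite_and, mul_ite, mul_one, mul_zero]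
  refine if_congr ?_ rfl rfl
  constructor
  · rintro ⟨hε, ⟨⟨h₁, h₂⟩, hoff⟩, hδ⟩
    change δ (Fin.last (m + 1)).castSucc = ε (Fin.last (m + 2)) at h₁
    change δ (Fin.last (m + 2)) = ε (Fin.last (m + 1)).castSucc at h₂
    have h₀ : δ (Fin.castSucc 0) = ε (Fin.castSucc 0) := hoff _ (by simp) (by simp)
    have hε' : ∀ i, ε i = ε (Fin.castSucc 0) := Fin.forall_fin_succ'.2
      ⟨fun i => hε i 0, by rw [← h₁, hδ _ 0, h₀]⟩
    have hδ' : ∀ i, δ i = ε (Fin.castSucc 0) := Fin.forall_fin_succ'.2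
      ⟨fun i => by rw [hδ i 0, h₀], by rw [h₂, hε _ 0]⟩
    exact ⟨funext fun i => (hδ' i).trans (hε' i).symm, fun i j => (hδ' i).trans (hδ' j).symm⟩
  · rintro ⟨rfl, h⟩
    exact ⟨fun _ _ => h _ _, ⟨⟨h _ _, h _ _⟩, fun _ _ _ => rfl⟩, fun _ _ => h _ _⟩

lemma tP_eq_extremalProj (m : ℕ) : tP (m + 2) = extremalProj (m + 2) := by
  induction m with
  | zero => exact tP_two
  | succ m ih =>
    rw [← extremalProj_succ, ← ih]
    rfl

/-- `t_m` annihilates all cap-cup generators `u_j`, `0 ≤ j ≤ m-1`. -/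
theorem tP_annihilates_capcups (m : ℕ) (hm : 2 ≤ m) (j : ℕ) (hj : j ≤ m - 1) :
    tP m * uFull m j = 0 ∧ uFull m j * tP m = 0 := by
  obtain ⟨m, rfl⟩ := Nat.exists_eq_add_of_le' hm
  rw [tP_eq_extremalProj, uFull]
  split_ifs
  · have hd := extremalProj_commute_dRot (m + 2)
    have hi := Matrix.commute_inv_right hd
    constructor
    · rw [← mul_assoc, ← mul_assoc, hi.eq, mul_assoc (dRot (m + 2))⁻¹, extremalProj_mul_capcup,
        mul_zero, zero_mul]
    · rw [mul_assoc, ← hd.eq, ← mul_assoc, mul_assoc (dRot (m + 2))⁻¹, capcup_mul_extremalProj,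
        mul_zero, zero_mul]
  · exact ⟨extremalProj_mul_capcup _ _, capcup_mul_extremalProj _ _⟩
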